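/- Let G = G₁ ∪ G₂ be a graph with V(G₁) ∩ V(G₂) = {v}. Then 𝔠(G) = 𝒜 ∪ ℬ ∪ 𝒞 ∪ 𝒟, where 𝒜 = {S₁ ∪ S₂ : S₁ ∈ 𝔠(G₁), S₂ ∈ 𝔠(G₂) and v ∉ S₁ ∪ S₂}; ℬ = {T₁ ∪ S₂ : S₂ ∈ 𝔠(G₂) with v ∈ S₂, and T₁ ∈ 𝔠(G₁∖{v})}; 𝒞 = {S₁ ∪ T₂ : S₁ ∈ 𝔠(G₁) with v ∈ S₁, and T₂ ∈ 𝔠(G₂∖{v})}; 𝒟 = {T₁ ∪ T₂ ∪ {v} : for i = 1,2, T_i ∈ 𝔠(G_i∖{v}) and N_{G_i}(v) ⊄ T_i}. -/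

import Mathlib

open SimpleGraph

universe u u'

/-- The number of connected components of the induced subgraph of `G` on the vertex set `A`. -/
noncomputable def cComp {V : Type u} (G : SimpleGraph V) (A : Set V) : ℕ :=
  Nat.card (G.induce A).ConnectedComponent

/-- `x` is a cut vertex of the induced subgraph of `G` on `A`: removing `x`
increases the number of connected components. -/
def CutVertexOn {V : Type u} (G : SimpleGraph V) (A : Set V) (x : V) : Prop :=
  x ∈ A ∧ cComp G A < cComp G (A \ {x})

/-- `T` is a cutset of the induced subgraph of `G` on `A`: every `t ∈ T` is a
cut vertex of `G[A] ∖ (T ∖ {t})`. -/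
def CutsetOn {V : Type u} [DecidableEq V] (G : SimpleGraph V) (A : Set V) (T : Finset V) :
    Prop :=
  ↑T ⊆ A ∧ ∀ t ∈ T, CutVertexOn G (A \ ↑(T.erase t)) t

/-- The binomial edge ideal of the induced subgraph of `G` on `A` is unmixed
(combinatorial characterization): `c(T) = |T| + c(∅)` for every cutset `T`. -/
def UnmixedOn {V : Type u} [DecidableEq V] (G : SimpleGraph V) (A : Set V) : Prop :=
  ∀ T : Finset V, CutsetOn G A T → cComp G (A \ ↑T) = T.card + cComp G A

/-- The induced subgraph of `G` on `A` is accessible. -/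
def AccessibleOn {V : Type u} [DecidableEq V] (G : SimpleGraph V) (A : Set V) : Prop :=
  UnmixedOn G A ∧
    ∀ T : Finset V, CutsetOn G A T → T.Nonempty → ∃ t ∈ T, CutsetOn G A (T.erase t)

/-- The graph `(G[A])_x`: add all edges between neighbours of `x` lying in `A`. -/
def cliqueAtOn {V : Type u} (G : SimpleGraph V) (A : Set V) (x : V) : SimpleGraph V :=
  G ⊔ SimpleGraph.fromRel (fun a b => a ∈ A ∧ b ∈ A ∧ G.Adj x a ∧ G.Adj x b)

/-- The binomial edge ideal of the induced subgraph of `G` on `A` is strongly unmixed. -/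
inductive StronglyUnmixedOn {V : Type u} [DecidableEq V] : SimpleGraph V → Set V → Prop
  | complete (G : SimpleGraph V) (A : Set V)
      (h : ∀ a b : A, (G.induce A).Reachable a b → a ≠ b → (G.induce A).Adj a b) :
      StronglyUnmixedOn G A
  | cut (G : SimpleGraph V) (A : Set V) (hU : UnmixedOn G A) (x : V)
      (hx : CutVertexOn G A x)
      (h1 : StronglyUnmixedOn G (A \ {x}))
      (h2 : StronglyUnmixedOn (cliqueAtOn G A x) A)
      (h3 : StronglyUnmixedOn (cliqueAtOn G A x) (A \ {x})) :
      StronglyUnmixedOn G A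

/-- `x` is a free vertex of `G`: the induced subgraph on `N(x) ∪ {x}` is complete. -/
def FreeVertex {V : Type u} (G : SimpleGraph V) (x : V) : Prop :=
  ∀ a b : V, G.Adj x a → G.Adj x b → a ≠ b → G.Adj a b

/-- Attach a whisker (pendant vertex) at each vertex of `Wv`.  `Sum.inl a` is the
original vertex `a` and `Sum.inr x` is the whisker vertex `f_x` attached at `x ∈ Wv`. -/
def whiskered {V : Type u} (G : SimpleGraph V) (Wv : Set V) : SimpleGraph (V ⊕ V) :=
  SimpleGraph.fromRel (fun a b =>
    (∃ x y, G.Adj x y ∧ a = Sum.inl x ∧ b = Sum.inl y) ∨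
    (∃ x ∈ Wv, a = Sum.inl x ∧ b = Sum.inr x))

/-- `B` is (the vertex set of) a block of `G`: a maximal connected induced
subgraph having no cut vertex. -/
def IsBlock {V : Type u} (G : SimpleGraph V) (B : Set V) : Prop :=
  (G.induce B).Connected ∧ (∀ x, ¬ CutVertexOn G B x) ∧
    ∀ B' : Set V, B ⊆ B' → (G.induce B').Connected → (∀ x, ¬ CutVertexOn G B' x) → B' = B

/-- Glue two graphs `G` and `H`, identifying the vertex `x` of `G` with the vertex
`y` of `H` (the identified vertex is `Sum.inl x`). -/
def glueAt {V : Type u} {W : Type u'} (G : SimpleGraph V) (H : SimpleGraph W) (x : V) (y : W) :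
    SimpleGraph (V ⊕ W) :=
  SimpleGraph.fromRel (fun a b =>
    (∃ p q, G.Adj p q ∧ a = Sum.inl p ∧ b = Sum.inl q) ∨
    (∃ p q, H.Adj p q ∧ p ≠ y ∧ q ≠ y ∧ a = Sum.inr p ∧ b = Sum.inr q) ∨
    (∃ q, H.Adj y q ∧ a = Sum.inl x ∧ b = Sum.inr q))

/-- The star product `K_m ⋆_r K_n`: two complete graphs, on `{x₁,…,x_m}` (the `inl`s)
and `{y₁,…,y_n}` (the `inr`s), together with the matching edges `{x_i, y_i}` for `1 ≤ i ≤ r`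
(indices `0,…,r-1` here). -/
def starProd (m n r : ℕ) : SimpleGraph (Fin m ⊕ Fin n) :=
  SimpleGraph.fromRel (fun a b =>
    (∃ x y : Fin m, a = Sum.inl x ∧ b = Sum.inl y) ∨
    (∃ x y : Fin n, a = Sum.inr x ∧ b = Sum.inr y) ∨
    (∃ (x : Fin m) (y : Fin n), (x : ℕ) = (y : ℕ) ∧ (x : ℕ) < r ∧
      a = Sum.inl x ∧ b = Sum.inr y))

/-- The vertices `x_i, y_i` for `2 ≤ i ≤ r` (indices `1,…,r-1` here), at which
whiskers are attached to form `overline(K_m ⋆_r K_n)`. -/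
def starWhisk (m n r : ℕ) : Set (Fin m ⊕ Fin n) :=
  {a | (∃ x : Fin m, a = Sum.inl x ∧ 1 ≤ (x : ℕ) ∧ (x : ℕ) < r) ∨
       (∃ y : Fin n, a = Sum.inr y ∧ 1 ≤ (y : ℕ) ∧ (y : ℕ) < r)}

/-- `a` and `b` both lie in `A` and are joined by a path of the induced subgraph of `G` on `A`. -/
def ReachIn {V : Type u} (G : SimpleGraph V) (A : Set V) (a b : V) : Prop :=
  ∃ (ha : a ∈ A) (hb : b ∈ A), (G.induce A).Reachable ⟨a, ha⟩ ⟨b, hb⟩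

/-- Auxiliary (connected case): `G[A]` has no cut vertex, or for every cut vertex `x`,
every connected component of `G[A] ∖ {x}` contains at most `r` cut vertices of `G[A] ∖ {x}`. -/
def RCutConnAux {V : Type u} (G : SimpleGraph V) (A : Set V) (r : ℕ) : Prop :=
  (∀ x, ¬ CutVertexOn G A x) ∨
    ∀ x, CutVertexOn G A x → ∀ a ∈ A \ {x},
      Set.ncard {w | CutVertexOn G (A \ {x}) w ∧ ReachIn G (A \ {x}) a w} ≤ r

/-- `G[A]` is `r`-cut-connected: every connected component of `G[A]` satisfies the
condition of `RCutConnAux`. -/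
def RCutConn {V : Type u} (G : SimpleGraph V) (A : Set V) (r : ℕ) : Prop :=
  ∀ a ∈ A, RCutConnAux G {b | ReachIn G A a b} r

/-- `G[A]` is strongly `r`-cut-connected: it is `r`-cut-connected and, recursively,
`G[A] ∖ {x}` is strongly `r`-cut-connected for every cut vertex `x`. -/
inductive StronglyRCutConn {V : Type u} (r : ℕ) : SimpleGraph V → Set V → Prop
  | mk (G : SimpleGraph V) (A : Set V) (h1 : RCutConn G A r)
      (h2 : ∀ x, CutVertexOn G A x → StronglyRCutConn r G (A \ {x})) :
      StronglyRCutConn r G A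

section ReachIn

variable {V : Type u} {G : SimpleGraph V} {A B : Set V} {a b c : V}

theorem ReachIn.refl (ha : a ∈ A) : ReachIn G A a a :=
  ⟨ha, ha, Reachable.refl _⟩

theorem ReachIn.left_mem (h : ReachIn G A a b) : a ∈ A := h.1

theorem ReachIn.right_mem (h : ReachIn G A a b) : b ∈ A := h.2.1

theorem ReachIn.symm (h : ReachIn G A a b) : ReachIn G A b a :=
  ⟨h.2.1, h.1, h.2.2.symm⟩

theorem ReachIn.trans (h : ReachIn G A a b) (h' : ReachIn G A b c) : ReachIn G A a c :=
  ⟨h.1, h'.2.1, h.2.2.trans h'.2.2⟩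

theorem ReachIn.of_adj (ha : a ∈ A) (hb : b ∈ A) (h : G.Adj a b) : ReachIn G A a b :=
  ⟨ha, hb, Adj.reachable (G := G.induce A) (u := ⟨a, ha⟩) (v := ⟨b, hb⟩) h⟩

/-- Induction along a path of `G[A]` starting at `a`. -/
theorem ReachIn.induction {P : V → Prop} (h : ReachIn G A a b) (base : P a)
    (step : ∀ x y, x ∈ A → y ∈ A → G.Adj x y → P x → P y) : P b := by
  obtain ⟨ha, hb, ⟨w⟩⟩ := h
  have key : ∀ {x y : A} (_ : (G.induce A).Walk x y), P x → P y := by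
    intro x y w
    induction w with
    | nil => exact id
    | cons hadj _ ih => exact fun hx => ih (step _ _ (Subtype.prop _) (Subtype.prop _) hadj hx)
  exact key w base

theorem ReachIn.mono (hAB : A ⊆ B) (h : ReachIn G A a b) : ReachIn G B a b :=
  h.induction (P := fun x => ReachIn G B a x) (.refl (hAB h.left_mem))
    fun _ _ hx hy hxy hax => hax.trans (.of_adj (hAB hx) (hAB hy) hxy)

end ReachIn

/-- `x` has two neighbours in `B` lying in different components of `G[B]`. -/
def Separates {V : Type u} (G : SimpleGraph V) (B : Set V) (x : V) : Prop :=
  ∃ a ∈ B, ∃ b ∈ B, G.Adj x a ∧ G.Adj x b ∧ ¬ ReachIn G B a b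

/-- If the neighbours of `x` in `A \ {x}` are pairwise connected in `G[A \ {x}]`, then paths of
`G[A]` can be rerouted to avoid `x`. -/
theorem ReachIn.diff_singleton {V : Type u} {G : SimpleGraph V} {A : Set V} {a b x : V}
    (hx : ¬ Separates G (A \ {x}) x) (hax : a ≠ x) (hbx : b ≠ x) (h : ReachIn G A a b) :
    ReachIn G (A \ {x}) a b := by
  have key : (b ≠ x → ReachIn G (A \ {x}) a b) ∧
      (b = x → ∃ c, G.Adj x c ∧ ReachIn G (A \ {x}) a c) := by
    refine h.induction (P := fun b => (b ≠ x → ReachIn G (A \ {x}) a b) ∧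
      (b = x → ∃ c, G.Adj x c ∧ ReachIn G (A \ {x}) a c))
      ⟨fun _ => .refl ⟨h.left_mem, hax⟩, fun h => absurd h hax⟩ ?_
    rintro y z hy hz hyz ⟨h₁, h₂⟩
    by_cases hyx : y = x
    · subst hyx
      refine ⟨fun hzy => ?_, fun hzy => absurd hzy.symm hyz.ne⟩
      obtain ⟨c, hc, hac⟩ := h₂ rfl
      by_contra hcon
      exact hx ⟨c, hac.right_mem, z, ⟨hz, hzy⟩, hc, hyz, fun hcz => hcon (hac.trans hcz)⟩
    · refine ⟨fun hzx => (h₁ hyx).trans (.of_adj ⟨hy, hyx⟩ ⟨hz, hzx⟩ hyz), fun hzx => ?_⟩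
      exact ⟨y, hzx ▸ hyz.symm, h₁ hyx⟩
  exact key.1 hbx

theorem cutVertexOn_iff {V : Type u} [Finite V] (G : SimpleGraph V) (A : Set V) (x : V) :
    CutVertexOn G A x ↔ x ∈ A ∧ Separates G (A \ {x}) x := by
  refine and_congr_right fun hxA => ?_
  let f : G.induce (A \ {x}) →g G.induce A := (induceHomOfLE G Set.sdiff_subset).toHom
  let π : (G.induce (A \ {x})).ConnectedComponent → (G.induce A).ConnectedComponent :=
    ConnectedComponent.map f
  constructor
  · intro hlt
    by_contra hx
    refine hlt.not_ge (Nat.card_le_card_of_injective π ?_)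
    intro c d
    refine ConnectedComponent.ind₂ (fun a b hab => ?_) c d
    have hr : ReachIn G A a b := ⟨a.2.1, b.2.1, ConnectedComponent.exact hab⟩
    exact ConnectedComponent.sound (hr.diff_singleton hx a.2.2 b.2.2).2.2
  · rintro ⟨a, ha, b, hb, hxa, hxb, hab⟩
    have hsurj : Function.Surjective π := by
      refine ConnectedComponent.ind fun y => ?_
      by_cases hy : (y : V) = x
      · refine ⟨(G.induce _).connectedComponentMk ⟨a, ha⟩, ConnectedComponent.sound ?_⟩
        have h : ReachIn G A a y := .of_adj ha.1 y.2 (hy ▸ hxa.symm)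
        exact h.2.2
      · exact ⟨(G.induce _).connectedComponentMk ⟨y, y.2, hy⟩, rfl⟩
    refine lt_of_le_of_ne (Nat.card_le_card_of_surjective π hsurj) fun hcard => hab ?_
    have hinj : Function.Injective π :=
      ((Nat.bijective_iff_surjective_and_card π).2 ⟨hsurj, hcard.symm⟩).1
    have h : ReachIn G A a b :=
      (ReachIn.of_adj ha.1 hxA hxa.symm).trans (.of_adj hxA hb.1 hxb)
    have hπ : π ((G.induce _).connectedComponentMk ⟨a, ha⟩) =
        π ((G.induce _).connectedComponentMk ⟨b, hb⟩) := ConnectedComponent.sound h.2.2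
    exact ⟨ha, hb, ConnectedComponent.exact (hinj hπ)⟩

theorem cutsetOn_iff {V : Type u} [Finite V] [DecidableEq V] (G : SimpleGraph V) (A : Set V)
    (T : Finset V) :
    CutsetOn G A T ↔ ↑T ⊆ A ∧ ∀ t ∈ T, Separates G (A \ ↑T) t := by
  refine and_congr_right fun hTA => forall₂_congr fun t ht => ?_
  have hset : (A \ ↑(T.erase t)) \ {t} = A \ (T : Set V) := by
    ext y
    by_cases hy : y = t <;> simp [hy, ht]
  rw [cutVertexOn_iff, hset, and_iff_right]
  exact ⟨hTA ht, by simp⟩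

section Gluing

variable {V : Type u} {G : SimpleGraph V} {A₁ A₂ B : Set V} {a b t v : V}

/-- A path starting in `A₁` stays in `A₁` or leaves it through `v`. -/
theorem ReachIn.mem_or_through (hinter : A₁ ∩ A₂ = {v})
    (hedge : ∀ a b : V, G.Adj a b → (a ∈ A₁ ∧ b ∈ A₁) ∨ (a ∈ A₂ ∧ b ∈ A₂))
    (ha : a ∈ A₁) (h : ReachIn G B a b) :
    (b ∈ A₁ → ReachIn G (B ∩ A₁) a b) ∧ (b ∉ A₁ → ReachIn G (B ∩ A₁) a v) := by
  have hv : ∀ y, y ∈ A₁ → y ∈ A₂ → y = v := fun y h₁ h₂ => hinter.subset ⟨h₁, h₂⟩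
  refine h.induction (P := fun b => (b ∈ A₁ → ReachIn G (B ∩ A₁) a b) ∧
    (b ∉ A₁ → ReachIn G (B ∩ A₁) a v))
    ⟨fun _ => .refl ⟨h.left_mem, ha⟩, fun h => absurd ha h⟩ ?_
  rintro x y hx hy hxy ⟨h₁, h₂⟩
  by_cases hx₁ : x ∈ A₁ <;> by_cases hy₁ : y ∈ A₁
  · exact ⟨fun _ => (h₁ hx₁).trans (.of_adj ⟨hx, hx₁⟩ ⟨hy, hy₁⟩ hxy), fun h => absurd hy₁ h⟩
  · have hxv : x = v := hv x hx₁ (by grind)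
    exact ⟨fun h => absurd h hy₁, fun _ => hxv ▸ h₁ hx₁⟩
  · have hyv : y = v := hv y hy₁ (by grind)
    exact ⟨fun _ => hyv ▸ h₂ hx₁, fun h => absurd hy₁ h⟩
  · exact ⟨fun h => absurd h hy₁, fun _ => h₂ hx₁⟩

theorem reachIn_inter_iff (hinter : A₁ ∩ A₂ = {v})
    (hedge : ∀ a b : V, G.Adj a b → (a ∈ A₁ ∧ b ∈ A₁) ∨ (a ∈ A₂ ∧ b ∈ A₂))
    (ha : a ∈ A₁) (hb : b ∈ A₁) : ReachIn G (B ∩ A₁) a b ↔ ReachIn G B a b :=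
  ⟨.mono Set.inter_subset_left, fun h => (h.mem_or_through hinter hedge ha).1 hb⟩

theorem Separates.of_inter (hinter : A₁ ∩ A₂ = {v})
    (hedge : ∀ a b : V, G.Adj a b → (a ∈ A₁ ∧ b ∈ A₁) ∨ (a ∈ A₂ ∧ b ∈ A₂))
    (h : Separates G (B ∩ A₁) t) : Separates G B t := by
  obtain ⟨a, ha, b, hb, hta, htb, hab⟩ := h
  rw [reachIn_inter_iff hinter hedge ha.2 hb.2] at hab
  exact ⟨a, ha.1, b, hb.1, hta, htb, hab⟩

theorem separates_inter_iff (hinter : A₁ ∩ A₂ = {v})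
    (hedge : ∀ a b : V, G.Adj a b → (a ∈ A₁ ∧ b ∈ A₁) ∨ (a ∈ A₂ ∧ b ∈ A₂))
    (ht : t ∈ A₁) (htv : t ≠ v) : Separates G (B ∩ A₁) t ↔ Separates G B t := by
  refine ⟨.of_inter hinter hedge, ?_⟩
  rintro ⟨a, ha, b, hb, hta, htb, hab⟩
  have hN : ∀ y, G.Adj t y → y ∈ A₁ := fun y hy =>
    (hedge t y hy).elim And.right fun h => absurd (hinter.subset ⟨ht, h.1⟩) htv
  rw [← reachIn_inter_iff hinter hedge (hN a hta) (hN b htb)] at hab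
  exact ⟨a, ⟨ha, hN a hta⟩, b, ⟨hb, hN b htb⟩, hta, htb, hab⟩

/-- The ways in which the gluing vertex `v` can separate `G[B]`, when `v ∉ B`. -/
theorem separates_gluing_iff (hinter : A₁ ∩ A₂ = {v})
    (hedge : ∀ a b : V, G.Adj a b → (a ∈ A₁ ∧ b ∈ A₁) ∨ (a ∈ A₂ ∧ b ∈ A₂)) (hvB : v ∉ B) :
    Separates G B v ↔ Separates G (B ∩ A₁) v ∨ Separates G (B ∩ A₂) v ∨
      (∃ a ∈ B ∩ A₁, G.Adj v a) ∧ ∃ b ∈ B ∩ A₂, G.Adj v b := by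
  have hinter' : A₂ ∩ A₁ = {v} := Set.inter_comm A₁ A₂ ▸ hinter
  have hedge' := fun a b h => (hedge a b h).symm
  constructor
  · rintro ⟨a, ha, b, hb, hva, hvb, hab⟩
    rcases hedge v a hva with ⟨-, ha'⟩ | ⟨-, ha'⟩ <;> rcases hedge v b hvb with ⟨-, hb'⟩ | ⟨-, hb'⟩
    · rw [← reachIn_inter_iff hinter hedge ha' hb'] at hab
      exact .inl ⟨a, ⟨ha, ha'⟩, b, ⟨hb, hb'⟩, hva, hvb, hab⟩
    · exact .inr (.inr ⟨⟨a, ⟨ha, ha'⟩, hva⟩, b, ⟨hb, hb'⟩, hvb⟩)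
    · exact .inr (.inr ⟨⟨b, ⟨hb, hb'⟩, hvb⟩, a, ⟨ha, ha'⟩, hva⟩)
    · rw [← reachIn_inter_iff hinter' hedge' ha' hb'] at hab
      exact .inr (.inl ⟨a, ⟨ha, ha'⟩, b, ⟨hb, hb'⟩, hva, hvb, hab⟩)
  · rintro (h | h | ⟨⟨a, ⟨ha, ha₁⟩, hva⟩, b, ⟨hb, hb₂⟩, hvb⟩)
    · exact .of_inter hinter hedge h
    · exact .of_inter hinter' hedge' h
    · refine ⟨a, ha, b, hb, hva, hvb, fun hab => ?_⟩
      have hb₁ : b ∉ A₁ := fun hb₁ => hvB <| by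
        rwa [← show b = v from hinter.subset ⟨hb₁, hb₂⟩]
      exact hvB ((hab.mem_or_through hinter hedge ha₁).2 hb₁).right_mem.1

end Gluing

/-- Proposition (cutsets of a decomposition `G = G₁ ∪ G₂` with
`V(G₁) ∩ V(G₂) = {v}`): `𝔠(G) = 𝒜 ∪ ℬ ∪ 𝒞 ∪ 𝒟`. -/
theorem cutsets_of_union {V : Type u} [Fintype V] [DecidableEq V]
    (G : SimpleGraph V) (A₁ A₂ : Set V) (v : V)
    (hunion : A₁ ∪ A₂ = Set.univ) (hinter : A₁ ∩ A₂ = {v})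
    (hedge : ∀ a b : V, G.Adj a b → (a ∈ A₁ ∧ b ∈ A₁) ∨ (a ∈ A₂ ∧ b ∈ A₂))
    (T : Finset V) :
    CutsetOn G Set.univ T ↔
      ((∃ S₁ S₂ : Finset V, CutsetOn G A₁ S₁ ∧ CutsetOn G A₂ S₂ ∧
          v ∉ S₁ ∪ S₂ ∧ T = S₁ ∪ S₂) ∨
       (∃ T₁ S₂ : Finset V, CutsetOn G (A₁ \ {v}) T₁ ∧ CutsetOn G A₂ S₂ ∧
          v ∈ S₂ ∧ T = T₁ ∪ S₂) ∨
       (∃ S₁ T₂ : Finset V, CutsetOn G A₁ S₁ ∧ v ∈ S₁ ∧ CutsetOn G (A₂ \ {v}) T₂ ∧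
          T = S₁ ∪ T₂) ∨
       (∃ T₁ T₂ : Finset V, CutsetOn G (A₁ \ {v}) T₁ ∧ CutsetOn G (A₂ \ {v}) T₂ ∧
          ¬ (A₁ ∩ G.neighborSet v ⊆ ↑T₁) ∧ ¬ (A₂ ∩ G.neighborSet v ⊆ ↑T₂) ∧
          T = T₁ ∪ T₂ ∪ {v})) := by
  classical
  have hinter' : A₂ ∩ A₁ = {v} := Set.inter_comm A₁ A₂ ▸ hinter
  have hedge' := fun a b h => (hedge a b h).symm
  have hv : ∀ y, y ∈ A₁ → y ∈ A₂ → y = v := fun y h₁ h₂ => hinter.subset ⟨h₁, h₂⟩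
  have hv₁ : v ∈ A₁ := (hinter.superset rfl).1
  have hv₂ : v ∈ A₂ := (hinter.superset rfl).2
  have hU : ∀ y, y ∈ A₁ ∨ y ∈ A₂ := fun y => hunion.superset (Set.mem_univ y)
  have hB₁ : (Set.univ \ (T : Set V)) ∩ A₁ = A₁ \ ↑T := by grind
  have hB₂ : (Set.univ \ (T : Set V)) ∩ A₂ = A₂ \ ↑T := by grind
  have s₁ : ∀ t ∈ A₁, t ≠ v → (Separates G (A₁ \ ↑T) t ↔ Separates G (Set.univ \ ↑T) t) :=
    fun t ht htv => hB₁ ▸ separates_inter_iff hinter hedge ht htv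
  have s₂ : ∀ t ∈ A₂, t ≠ v → (Separates G (A₂ \ ↑T) t ↔ Separates G (Set.univ \ ↑T) t) :=
    fun t ht htv => hB₂ ▸ separates_inter_iff hinter' hedge' ht htv
  have sv : v ∈ T → _ := fun hvT =>
    separates_gluing_iff (B := Set.univ \ ↑T) hinter hedge (by simpa using hvT)
  rw [hB₁, hB₂] at sv
  simp only [cutsetOn_iff]
  constructor
  · rintro ⟨-, h⟩
    let S₁ := T.filter (· ∈ A₁)
    let S₂ := T.filter (· ∈ A₂)
    have e₁ : A₁ \ (S₁ : Set V) = A₁ \ ↑T := by ext y; simp [S₁]; tauto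
    have e₂ : A₂ \ (S₂ : Set V) = A₂ \ ↑T := by ext y; simp [S₂]; tauto
    have c₁ : (S₁ : Set V) ⊆ A₁ := fun y hy => (Finset.mem_filter.1 hy).2
    have c₂ : (S₂ : Set V) ⊆ A₂ := fun y hy => (Finset.mem_filter.1 hy).2
    by_cases hvT : v ∈ T
    · have e₁' : (A₁ \ {v}) \ (S₁.erase v : Set V) = A₁ \ ↑T := by
        ext y; simp [S₁]; grind
      have e₂' : (A₂ \ {v}) \ (S₂.erase v : Set V) = A₂ \ ↑T := by
        ext y; simp [S₂]; grind
      have d₁ : ((S₁.erase v : Finset V) : Set V) ⊆ A₁ \ {v} ∧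
          ∀ t ∈ S₁.erase v, Separates G ((A₁ \ {v}) \ ↑(S₁.erase v)) t := by
        rw [e₁']; grind
      have d₂ : ((S₂.erase v : Finset V) : Set V) ⊆ A₂ \ {v} ∧
          ∀ t ∈ S₂.erase v, Separates G ((A₂ \ {v}) \ ↑(S₂.erase v)) t := by
        rw [e₂']; grind
      rcases (sv hvT).1 (h v hvT) with h₁ | h₂ | ⟨⟨a, ha, hva⟩, b, hb, hvb⟩
      · refine .inr (.inr (.inl ⟨S₁, S₂.erase v, ⟨c₁, ?_⟩, by grind, d₂, by grind⟩))
        rw [e₁]; grind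
      · refine .inr (.inl ⟨S₁.erase v, S₂, d₁, ⟨c₂, ?_⟩, by grind, by grind⟩)
        rw [e₂]; grind
      · refine .inr (.inr (.inr ⟨S₁.erase v, S₂.erase v, d₁, d₂, ?_, ?_, by grind⟩))
        · exact fun hs => ha.2 <|
            Finset.mem_of_mem_filter _ (Finset.mem_of_mem_erase (hs ⟨ha.1, hva⟩))
        · exact fun hs => hb.2 <|
            Finset.mem_of_mem_filter _ (Finset.mem_of_mem_erase (hs ⟨hb.1, hvb⟩))
    · refine .inl ⟨S₁, S₂, ⟨c₁, ?_⟩, ⟨c₂, ?_⟩, by grind, by grind⟩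
      · rw [e₁]; grind
      · rw [e₂]; grind
  · intro h
    refine ⟨Set.subset_univ _, ?_⟩
    rcases h with ⟨S₁, S₂, ⟨c₁, h₁⟩, ⟨c₂, h₂⟩, hvT, hT⟩ | ⟨S₁, S₂, ⟨c₁, h₁⟩, ⟨c₂, h₂⟩, hvT, hT⟩ |
      ⟨S₁, S₂, ⟨c₁, h₁⟩, hvT, ⟨c₂, h₂⟩, hT⟩ | ⟨S₁, S₂, ⟨c₁, h₁⟩, ⟨c₂, h₂⟩, n₁, n₂, hT⟩
    · replace c₁ : ∀ y ∈ S₁, y ∈ A₁ := fun y hy => c₁ hy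
      replace c₂ : ∀ y ∈ S₂, y ∈ A₂ := fun y hy => c₂ hy
      have e₁ : A₁ \ (S₁ : Set V) = A₁ \ ↑T := by ext y; simp [hT]; grind
      have e₂ : A₂ \ (S₂ : Set V) = A₂ \ ↑T := by ext y; simp [hT]; grind
      rw [e₁] at h₁; rw [e₂] at h₂
      grind
    · replace c₁ : ∀ y ∈ S₁, y ∈ A₁ ∧ y ≠ v := fun y hy => c₁ hy
      replace c₂ : ∀ y ∈ S₂, y ∈ A₂ := fun y hy => c₂ hy
      have e₁ : (A₁ \ {v}) \ (S₁ : Set V) = A₁ \ ↑T := by ext y; simp [hT]; grind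
      have e₂ : A₂ \ (S₂ : Set V) = A₂ \ ↑T := by ext y; simp [hT]; grind
      rw [e₁] at h₁; rw [e₂] at h₂
      grind
    · replace c₁ : ∀ y ∈ S₁, y ∈ A₁ := fun y hy => c₁ hy
      replace c₂ : ∀ y ∈ S₂, y ∈ A₂ ∧ y ≠ v := fun y hy => c₂ hy
      have e₁ : A₁ \ (S₁ : Set V) = A₁ \ ↑T := by ext y; simp [hT]; grind
      have e₂ : (A₂ \ {v}) \ (S₂ : Set V) = A₂ \ ↑T := by ext y; simp [hT]; grind
      rw [e₁] at h₁; rw [e₂] at h₂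
      grind
    · replace c₁ : ∀ y ∈ S₁, y ∈ A₁ ∧ y ≠ v := fun y hy => c₁ hy
      replace c₂ : ∀ y ∈ S₂, y ∈ A₂ ∧ y ≠ v := fun y hy => c₂ hy
      have e₁ : (A₁ \ {v}) \ (S₁ : Set V) = A₁ \ ↑T := by ext y; simp [hT]; grind
      have e₂ : (A₂ \ {v}) \ (S₂ : Set V) = A₂ \ ↑T := by ext y; simp [hT]; grind
      rw [e₁] at h₁; rw [e₂] at h₂
      obtain ⟨a, ⟨ha, hva⟩, haS⟩ := Set.not_subset.1 n₁
      obtain ⟨b, ⟨hb, hvb⟩, hbS⟩ := Set.not_subset.1 n₂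
      have ha' : a ∈ A₁ \ (T : Set V) := e₁ ▸ ⟨⟨ha, hva.ne'⟩, haS⟩
      have hb' : b ∈ A₂ \ (T : Set V) := e₂ ▸ ⟨⟨hb, hvb.ne'⟩, hbS⟩
      have hsv := (sv (by simp [hT])).2 (.inr (.inr ⟨⟨a, ha', hva⟩, b, hb', hvb⟩))
      grind
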